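/- arXiv:2408.13130 — 2 statements merged into one kernel-verified Lean document; each statement's English description precedes it below -/
import Mathlib

section
/- Let G be a finite simple graph whose edges are coloured by a map κ into the colour set Fin (D+1), and suppose c ∈ Fin (D+1) is a colour such that every vertex of G is incident to at most one edge of colour c. If (R₁, E₁) is an S₁-rainbow subgraph of G and (R₂, E₂) is an S₂-rainbow subgraph of G with c ∈ S₁ ∩ S₂, then the cardinality of R₁ ∩ R₂ is even. -/
/-- `(R, E)` is an `S`-rainbow subgraph of the edge-coloured graph `(G, κ)`: `R` is a nonempty
set of vertices, every edge of `E` is an edge of `G` with both endpoints in `R` and colour in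
`S`, and every vertex of `R` is incident to exactly one edge of `E` of each colour in `S`. -/
def IsRainbowSubgraph {V : Type*} {D : ℕ} (G : SimpleGraph V) (κ : Sym2 V → Fin (D + 1))
    (S : Set (Fin (D + 1))) (R : Set V) (E : Set (Sym2 V)) : Prop :=
  R.Nonempty ∧
  (∀ e ∈ E, e ∈ G.edgeSet ∧ κ e ∈ S ∧ ∀ v ∈ e, v ∈ R) ∧
  (∀ v ∈ R, ∀ c ∈ S, ∃! e : Sym2 V, e ∈ E ∧ v ∈ e ∧ κ e = c)

/-- The edges of colour `c` common to `E₁` and `E₂`, as a subgraph of `G` on the vertex set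
`R₁ ∩ R₂`. -/
def commonColourSubgraph {V : Type*} {D : ℕ} {G : SimpleGraph V} {κ : Sym2 V → Fin (D + 1)}
    (c : Fin (D + 1)) {S₁ S₂ : Set (Fin (D + 1))} {R₁ R₂ : Set V} {E₁ E₂ : Set (Sym2 V)}
    (h₁ : IsRainbowSubgraph G κ S₁ R₁ E₁) (h₂ : IsRainbowSubgraph G κ S₂ R₂ E₂) :
    G.Subgraph where
  verts := R₁ ∩ R₂
  Adj v w := (s(v, w) ∈ E₁ ∧ s(v, w) ∈ E₂) ∧ κ s(v, w) = c
  adj_sub h := (h₁.2.1 _ h.1.1).1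
  edge_vert h := ⟨(h₁.2.1 _ h.1.1).2.2 _ (Sym2.mem_mk_left _ _),
    (h₂.2.1 _ h.1.2).2.2 _ (Sym2.mem_mk_left _ _)⟩
  symm := ⟨fun v w h => by rwa [Sym2.eq_swap]⟩

/-- If every vertex of `G` is incident to at most one edge of colour `c`, then any two rainbow
subgraphs whose colour sets both contain `c` intersect in an even number of vertices. -/
theorem rainbow_rainbow_even_intersection {V : Type*} [Fintype V] {D : ℕ}
    (G : SimpleGraph V) (κ : Sym2 V → Fin (D + 1)) (c : Fin (D + 1))
    (hc : ∀ v : V, ∀ e₁ ∈ G.edgeSet, ∀ e₂ ∈ G.edgeSet,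
      κ e₁ = c → κ e₂ = c → v ∈ e₁ → v ∈ e₂ → e₁ = e₂)
    (S₁ S₂ : Set (Fin (D + 1))) (hc₁ : c ∈ S₁) (hc₂ : c ∈ S₂)
    (R₁ R₂ : Set V) (E₁ E₂ : Set (Sym2 V))
    (h₁ : IsRainbowSubgraph G κ S₁ R₁ E₁) (h₂ : IsRainbowSubgraph G κ S₂ R₂ E₂) :
    Even ((R₁ ∩ R₂).ncard) := by
  have hM : (commonColourSubgraph c h₁ h₂).IsMatching := by
    rintro v ⟨hv₁, hv₂⟩
    obtain ⟨e₁, ⟨he₁, hve₁, hκ₁⟩, -⟩ := h₁.2.2 v hv₁ c hc₁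
    obtain ⟨e₂, ⟨he₂, hve₂, hκ₂⟩, -⟩ := h₂.2.2 v hv₂ c hc₂
    obtain rfl := hc v e₁ (h₁.2.1 _ he₁).1 e₂ (h₂.2.1 _ he₂).1 hκ₁ hκ₂ hve₁ hve₂
    obtain ⟨w, rfl⟩ := hve₁
    refine ⟨w, ⟨⟨he₁, he₂⟩, hκ₁⟩, fun u hu => ?_⟩
    exact Sym2.congr_right.mp <| hc v _ (h₁.2.1 _ hu.1.1).1 _ (h₁.2.1 _ he₁).1 hu.2 hκ₁
      (Sym2.mem_mk_left _ _) (Sym2.mem_mk_left _ _)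
  have : Fintype (commonColourSubgraph c h₁ h₂).verts := Fintype.ofFinite _
  have hcard := hM.even_card
  rwa [← Set.ncard_eq_toFinset_card'] at hcard
end

section
/- Let D ≥ 1 and d ≥ 1 be natural numbers. For each i ∈ Fin D let Gᵢ be a finite simple graph on vertex set Vᵢ equipped with a map ℓᵢ : Vᵢ → Fin 2 such that adjacent vertices of Gᵢ receive different values of ℓᵢ (a bipartition into level-0 and level-1 vertices), and suppose every vertex of every Gᵢ has degree exactly d. Consider the box product graph on Π_{i} Vᵢ, in which x and y are adjacent iff there exists j with Gⱼ.Adj (x j) (y j) and x i = y i for all i ≠ j. Fix a vertex x⁰ with ℓᵢ(x⁰ i) = 0 for all i. Then the number of sequences v₀, v₁, …, v_D of vertices of the box product such that v₀ = x⁰, consecutive terms are adjacent in the box product, and for each k the total level Σᵢ ℓᵢ(v_k i) equals k, is exactly D! · d^D. -/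
/-- Removing the first vertex of a chain: a chain of length `n + 1` from `x` is a successor `y` of
`x` together with a chain of length `n` from `y`. -/
def chainSuccEquiv {X : Type*} (R : X → X → Prop) (n : ℕ) (x : X) :
    {v : Fin (n + 2) → X // v 0 = x ∧ ∀ k : Fin (n + 1), R (v k.castSucc) (v k.succ)} ≃
      Σ y : {y // R x y},
        {w : Fin (n + 1) → X // w 0 = y ∧ ∀ k : Fin n, R (w k.castSucc) (w k.succ)} where
  toFun v := ⟨⟨v.1 1, by have h := v.2.2 0; rw [Fin.castSucc_zero, v.2.1] at h; exact h⟩,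
    ⟨fun k => v.1 k.succ, rfl, fun k => v.2.2 k.succ⟩⟩
  invFun p := ⟨Fin.cons x p.2.1, rfl, by
    intro k
    cases k using Fin.cases with
    | zero => simpa [p.2.2.1] using p.1.2
    | succ k => simpa only [Fin.castSucc_succ, Fin.cons_succ] using p.2.2.2 k⟩
  left_inv := by
    rintro ⟨v, rfl, hv⟩
    exact Subtype.ext (Fin.cons_self_tail v)
  right_inv := by
    rintro ⟨⟨y, hy⟩, ⟨w, hw, hw'⟩⟩
    dsimp only at hw
    subst hw
    rfl

/-- If every `x` has `m x * d` successors, and `m` drops by one along each step, then the number of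
chains of length `n` from `x` is a descending factorial times `d ^ n`. -/
theorem card_chains_eq {X : Type*} [Finite X] (R : X → X → Prop) (m : X → ℕ) (d : ℕ)
    (hm : ∀ x y, R x y → m x = m y + 1) (hcard : ∀ x, Nat.card {y // R x y} = m x * d)
    (n : ℕ) (x : X) :
    Nat.card {v : Fin (n + 1) → X // v 0 = x ∧ ∀ k : Fin n, R (v k.castSucc) (v k.succ)} =
      (m x).descFactorial n * d ^ n := by
  induction n generalizing x with
  | zero =>
    have : Unique {v : Fin 1 → X // v 0 = x ∧ ∀ k : Fin 0, R (v k.castSucc) (v k.succ)} :=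
      { default := ⟨fun _ => x, rfl, fun k => k.elim0⟩
        uniq := by
          rintro ⟨v, hv, _⟩
          refine Subtype.ext (funext fun k => ?_)
          rw [Subsingleton.elim k 0]
          exact hv }
    rw [Nat.card_unique, Nat.descFactorial_zero, pow_zero, one_mul]
  | succ n ih =>
    have := Fintype.ofFinite {y // R x y}
    rw [Nat.card_congr (chainSuccEquiv R n x), Nat.card_sigma]
    have hstep : ∀ y : {y // R x y}, (m y.1).descFactorial n * d ^ n =
        (m x - 1).descFactorial n * d ^ n := fun y => by rw [hm x y y.2, Nat.add_sub_cancel]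
    simp only [ih, hstep]
    rw [Finset.sum_const, Finset.card_univ, ← Nat.card_eq_fintype_card, hcard, smul_eq_mul]
    cases m x with
    | zero => simp
    | succ p => rw [Nat.succ_descFactorial_succ, Nat.add_sub_cancel]; ring

/-- Changing a single coordinate changes a coordinatewise sum by the change in that coordinate. -/
theorem sum_add_eq_of_eq_off {ι : Type*} [Fintype ι] {V : ι → Type*} (f : ∀ i, V i → ℕ)
    {x y : ∀ i, V i} {j : ι} (h : ∀ i, i ≠ j → x i = y i) :
    ∑ i, f i (y i) + f j (x j) = ∑ i, f i (x i) + f j (y j) := by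
  classical
  rw [← Finset.add_sum_erase _ (fun i => f i (x i)) (Finset.mem_univ j),
    ← Finset.add_sum_erase _ (fun i => f i (y i)) (Finset.mem_univ j),
    Finset.sum_congr rfl fun i hi => congrArg (f i) (h i (Finset.ne_of_mem_erase hi)).symm]
  ring

/-- `y` is obtained from `x` by moving along an edge in a coordinate of level `0`. -/
def LevelStep {ι : Type*} {V : ι → Type*} (G : ∀ i, SimpleGraph (V i)) (ℓ : ∀ i, V i → Fin 2)
    (x y : ∀ i, V i) : Prop :=
  ∃ j, ℓ j (x j) = 0 ∧ (G j).Adj (x j) (y j) ∧ ∀ i, i ≠ j → x i = y i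

/-- A vertex one step above `x` amounts to a coordinate of level `0` and a neighbour there. -/
theorem card_levelStep {ι : Type*} [Fintype ι] {V : ι → Type*} [∀ i, Fintype (V i)]
    (G : ∀ i, SimpleGraph (V i)) [∀ i, DecidableRel (G i).Adj] (ℓ : ∀ i, V i → Fin 2) {d : ℕ}
    (hreg : ∀ i, ∀ v : V i, (G i).degree v = d) (x : ∀ i, V i) :
    Nat.card {y // LevelStep G ℓ x y} = (∑ i, if ℓ i (x i) = 0 then 1 else 0) * d := by
  classical
  let f : (Σ j : {j // ℓ j (x j) = 0}, (G j).neighborSet (x j)) → {y // LevelStep G ℓ x y} :=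
    fun p => ⟨Function.update x p.1.1 p.2.1, p.1.1, p.1.2, by
      rw [Function.update_self]; exact p.2.2,
      fun i hi => (Function.update_of_ne hi _ _).symm⟩
  have hf : Function.Bijective f := by
    constructor
    · rintro ⟨⟨j, hj⟩, ⟨a, ha⟩⟩ ⟨⟨j', hj'⟩, ⟨a', ha'⟩⟩ h
      have h : Function.update x j a = Function.update x j' a' := congrArg Subtype.val h
      rw [SimpleGraph.mem_neighborSet] at ha
      obtain rfl : j = j' := by
        by_contra hne
        have := congrFun h j
        rw [Function.update_self, Function.update_of_ne hne] at this
        exact ha.ne this.symm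
      obtain rfl := Function.update_injective x j h
      rfl
    · rintro ⟨y, j, hj, ha, hy⟩
      refine ⟨⟨⟨j, hj⟩, ⟨y j, ha⟩⟩, Subtype.ext ?_⟩
      exact Function.update_eq_iff.2 ⟨rfl, hy⟩
  rw [← Nat.card_congr (Equiv.ofBijective f hf), Nat.card_sigma]
  simp only [Nat.card_eq_fintype_card, SimpleGraph.card_neighborSet_eq_degree, hreg]
  rw [Finset.sum_const, Finset.card_univ, Fintype.card_subtype, Finset.card_filter, smul_eq_mul]

/-- In a box product of `D` bipartite `d`-regular graphs, the number of flags (paths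
`v₀, v₁, …, v_D` in the box product whose `k`-th vertex has total level `k`) starting at a
fixed level-`0` vertex `x₀` is exactly `D! · d^D`. -/
theorem card_flags_eq {D d : ℕ} (hD : 1 ≤ D) (hd : 1 ≤ d)
    (V : Fin D → Type*) [∀ i, Fintype (V i)]
    (G : ∀ i, SimpleGraph (V i)) [∀ i, DecidableRel (G i).Adj]
    (ℓ : ∀ i, V i → Fin 2)
    (hbip : ∀ i, ∀ a b : V i, (G i).Adj a b → ℓ i a ≠ ℓ i b)
    (hreg : ∀ i, ∀ v : V i, (G i).degree v = d)
    (x₀ : ∀ i, V i) (hx₀ : ∀ i, ℓ i (x₀ i) = 0) :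
    Nat.card {v : Fin (D + 1) → ∀ i, V i //
      v 0 = x₀ ∧
      (∀ k : Fin D, ∃ j, (G j).Adj (v k.castSucc j) (v k.succ j) ∧
        ∀ i, i ≠ j → v k.castSucc i = v k.succ i) ∧
      (∀ k : Fin (D + 1), (∑ i, ((ℓ i (v k i) : ℕ))) = (k : ℕ))} =
    Nat.factorial D * d ^ D := by
  have hm : ∀ x y, LevelStep G ℓ x y → (∑ i, if ℓ i (x i) = 0 then 1 else 0) =
      (∑ i, if ℓ i (y i) = 0 then 1 else 0) + 1 := by
    rintro x y ⟨j, hj, ha, h⟩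
    have hs := sum_add_eq_of_eq_off (fun i a => if ℓ i a = 0 then 1 else 0) h
    have hne := hbip j _ _ ha
    rw [hj] at hne
    simp only [hj, hne.symm, if_true, if_false] at hs
    exact hs.symm
  have hmain := card_chains_eq (LevelStep G ℓ) _ d hm (card_levelStep G ℓ hreg) D x₀
  simp only [hx₀, if_true, Finset.sum_const, Finset.card_univ, Fintype.card_fin, smul_eq_mul,
    mul_one, Nat.descFactorial_self] at hmain
  rw [← hmain]
  refine Nat.card_congr (Equiv.subtypeEquivRight fun v => and_congr_right fun hv => ⟨?_, ?_⟩)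
  · rintro ⟨hadj, hlev⟩ k
    obtain ⟨j, ha, h⟩ := hadj k
    refine ⟨j, ?_, ha, h⟩
    have hs := sum_add_eq_of_eq_off (fun i a => (ℓ i a : ℕ)) h
    have h₁ := hlev k.castSucc
    have h₂ := hlev k.succ
    rw [Fin.val_castSucc] at h₁
    rw [Fin.val_succ] at h₂
    ext
    simp only [Fin.val_zero]
    omega
  · intro hstep
    refine ⟨fun k => (hstep k).imp fun j h => h.2, fun k => ?_⟩
    induction k using Fin.induction with
    | zero => simp [hv, hx₀]
    | succ k ih =>
      obtain ⟨j, hj, ha, h⟩ := hstep k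
      have hs := sum_add_eq_of_eq_off (fun i a => (ℓ i a : ℕ)) h
      have hne := hbip j _ _ ha
      rw [hj, Ne, Fin.ext_iff] at hne
      simp only [hj, Fin.val_zero] at hs hne
      rw [Fin.val_castSucc] at ih
      rw [Fin.val_succ]
      omega
end
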